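/- arXiv:2409.02450 — 10 statements merged into one kernel-verified Lean document; each statement's English description precedes it below -/
import Mathlib

section
/- Let h : (0,∞) → (0,∞) be a continuous super-multiplicative function satisfying h(t) ≥ t for all t > 0, and let f : [a,b] → ℝ be a continuous h-mid-convex function. Then f is h-convex on [a,b], i.e. for all x, y ∈ [a,b] and all t ∈ (0,1), f(t·x + (1−t)·y) ≤ h(t)·f(x) + h(1−t)·f(y). -/
/-- A super-multiplicative function on the positive reals that dominates the identity is the
identity. -/
theorem eq_self_of_supermul_of_le {h : ℝ → ℝ}
    (h_supermul : ∀ x y : ℝ, 0 < x → 0 < y → h x * h y ≤ h (x * y))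
    (h_ge : ∀ t : ℝ, 0 < t → t ≤ h t) {t : ℝ} (ht : 0 < t) : h t = t := by
  have h_one : h 1 ≤ 1 := by
    have := h_supermul 1 1 one_pos one_pos
    rw [one_mul] at this
    nlinarith [h_ge 1 one_pos]
  refine le_antisymm ?_ (h_ge t ht)
  have hmul := h_supermul t t⁻¹ ht (inv_pos.2 ht)
  rw [mul_inv_cancel₀ ht.ne'] at hmul
  have hle : h t * t⁻¹ ≤ 1 :=
    (mul_le_mul_of_nonneg_left (h_ge t⁻¹ (inv_pos.2 ht)) (ht.le.trans (h_ge t ht))).trans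
      (hmul.trans h_one)
  rwa [← div_eq_mul_inv, div_le_one ht] at hle

/-- A continuous midpoint-convex function on `[0, 1]` that is nonpositive at both endpoints is
nonpositive. -/
theorem nonpos_of_midpoint_convex {g : ℝ → ℝ} (hg : ContinuousOn g (Set.Icc 0 1))
    (hmid : ∀ s ∈ Set.Icc (0 : ℝ) 1, ∀ t ∈ Set.Icc (0 : ℝ) 1, g ((s + t) / 2) ≤ (g s + g t) / 2)
    (h0 : g 0 ≤ 0) (h1 : g 1 ≤ 0) {t : ℝ} (ht : t ∈ Set.Icc (0 : ℝ) 1) : g t ≤ 0 := by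
  obtain ⟨m, hm, hmax⟩ := isCompact_Icc.exists_isMaxOn ⟨t, ht⟩ hg
  rw [isMaxOn_iff] at hmax
  have hS : IsCompact (Set.Icc (0 : ℝ) 1 ∩ g ⁻¹' {g m}) :=
    isCompact_Icc.of_isClosed_subset
      (hg.preimage_isClosed_of_isClosed isClosed_Icc isClosed_singleton) Set.inter_subset_left
  obtain ⟨c, ⟨⟨hc0, hc1⟩, hcm⟩, hleast⟩ := hS.exists_isLeast ⟨m, hm, rfl⟩
  replace hcm : g c = g m := hcm
  by_contra! hpos
  have hcpos : 0 < g c := hcm ▸ hpos.trans_le (hmax t ht)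
  have hc0' : 0 < c := hc0.lt_of_ne (by rintro rfl; linarith)
  have hc1' : c < 1 := hc1.lt_of_ne (by rintro rfl; linarith)
  obtain ⟨δ, hδ, hδ0, hδ1⟩ : ∃ δ > 0, δ ≤ c ∧ δ ≤ 1 - c :=
    ⟨min c (1 - c), lt_min hc0' (by linarith), min_le_left _ _, min_le_right _ _⟩
  have hl : c - δ ∈ Set.Icc (0 : ℝ) 1 := ⟨by linarith, by linarith⟩
  have hr : c + δ ∈ Set.Icc (0 : ℝ) 1 := ⟨by linarith, by linarith⟩
  have hlt : g (c - δ) < g m := (hmax _ hl).lt_of_ne fun heq => by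
    linarith [hleast ⟨hl, heq⟩]
  have hle := hmid _ hl _ hr
  rw [show (c - δ + (c + δ)) / 2 = c by ring] at hle
  linarith [hmax _ hr]


theorem h_mid_convex_continuous_implies_h_convex
    (a b : ℝ) (h f : ℝ → ℝ)
    (h_pos : ∀ t : ℝ, 0 < t → 0 < h t)
    (h_cont : ContinuousOn h (Set.Ioi (0 : ℝ)))
    (h_supermul : ∀ x y : ℝ, 0 < x → 0 < y → h x * h y ≤ h (x * y))
    (h_ge : ∀ t : ℝ, 0 < t → t ≤ h t)
    (f_cont : ContinuousOn f (Set.Icc a b))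
    (f_midconv : ∀ x ∈ Set.Icc a b, ∀ y ∈ Set.Icc a b,
      f ((x + y) / 2) ≤ h (1 / 2) * (f x + f y)) :
    ∀ x ∈ Set.Icc a b, ∀ y ∈ Set.Icc a b, ∀ t ∈ Set.Ioo (0 : ℝ) 1,
      f (t * x + (1 - t) * y) ≤ h t * f x + h (1 - t) * f y := by
  intro x hx y hy t ht
  have h_id : ∀ {s : ℝ}, 0 < s → h s = s := eq_self_of_supermul_of_le h_supermul h_ge
  rw [h_id ht.1, h_id (sub_pos.2 ht.2)]
  have hmem : ∀ s ∈ Set.Icc (0 : ℝ) 1, s * x + (1 - s) * y ∈ Set.Icc a b := fun s hs =>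
    convex_Icc a b hx hy hs.1 (sub_nonneg.2 hs.2) (by ring)
  have hg : ContinuousOn
      (fun s => f (s * x + (1 - s) * y) - (s * f x + (1 - s) * f y)) (Set.Icc 0 1) :=
    (f_cont.comp (by fun_prop) hmem).sub (by fun_prop)
  refine sub_nonpos.1 (nonpos_of_midpoint_convex hg ?_ (by simp) (by simp)
    (Set.Ioo_subset_Icc_self ht))
  intro r hr s hs
  have hmid := f_midconv _ (hmem r hr) _ (hmem s hs)
  rw [h_id (by norm_num), show (r * x + (1 - r) * y + (s * x + (1 - s) * y)) / 2 =
    (r + s) / 2 * x + (1 - (r + s) / 2) * y by ring] at hmid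
  linarith
end

section
/- Let h : (0,∞) → (0,∞) be a super-multiplicative function satisfying h(t) ≥ t for all t > 0, and let f : [a,b] → ℝ be an h-mid-convex function. Then for every n ∈ ℕ, every x₁, …, xₙ ∈ [a,b], and every choice of nonnegative rational numbers λ₁, …, λₙ with λ₁ + ⋯ + λₙ = 1 and each λᵢ > 0, one has f(∑_{i=1}^n λᵢ·xᵢ) ≤ ∑_{i=1}^n h(λᵢ)·f(xᵢ). -/
theorem eq_self_of_supermultiplicative_of_le {h : ℝ → ℝ}
    (h_pos : ∀ t : ℝ, 0 < t → 0 < h t)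
    (h_supermul : ∀ x y : ℝ, 0 < x → 0 < y → h x * h y ≤ h (x * y))
    (h_ge : ∀ t : ℝ, 0 < t → t ≤ h t) {t : ℝ} (ht : 0 < t) : h t = t := by
  refine le_antisymm ?_ (h_ge t ht)
  have one_le : h 1 ≤ 1 := by
    have := h_supermul 1 1 one_pos one_pos
    rw [mul_one] at this
    nlinarith [h_pos 1 one_pos]
  have hinv : h t * t⁻¹ ≤ 1 := calc
    h t * t⁻¹ ≤ h t * h t⁻¹ :=
      mul_le_mul_of_nonneg_left (h_ge _ (inv_pos.2 ht)) (h_pos t ht).le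
    _ ≤ h (t * t⁻¹) := h_supermul _ _ ht (inv_pos.2 ht)
    _ ≤ 1 := by rwa [mul_inv_cancel₀ ht.ne']
  rwa [← div_eq_mul_inv, div_le_one ht] at hinv

/-- A discrete maximum principle: a convex finite sequence with nonpositive endpoints is
nonpositive. -/
theorem nonpos_of_discrete_convex {u : ℕ → ℝ} {m : ℕ} (h0 : u 0 ≤ 0) (hm : u m ≤ 0)
    (hu : ∀ k, k + 2 ≤ m → 2 * u (k + 1) ≤ u k + u (k + 2)) {k : ℕ} (hk : k ≤ m) :
    u k ≤ 0 := by
  classical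
  obtain ⟨i, hi, hmax⟩ := (Finset.range (m + 1)).exists_max_image u ⟨0, by simp⟩
  have hex : ∃ j, j ≤ m ∧ u j = u i := ⟨i, by simpa [Nat.lt_succ_iff] using hi, rfl⟩
  obtain ⟨hjm, hji⟩ := Nat.find_spec hex
  have hmin := fun l => @Nat.find_min _ _ hex l
  generalize Nat.find hex = j at hjm hji hmin
  have hle : ∀ l ≤ m, u l ≤ u j := fun l hl =>
    hji ▸ hmax l (Finset.mem_range.2 (Nat.lt_succ_of_le hl))
  refine (hle k hk).trans ?_
  rcases j with _ | j
  · exact h0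
  rcases hjm.eq_or_lt with rfl | hlt
  · exact hm
  have hne : u j ≠ u (j + 1) := fun he => hmin j j.lt_succ_self ⟨by omega, he.trans hji⟩
  have hlt' := lt_of_le_of_ne (hle j (by omega)) hne
  linarith [hu j hlt, hle (j + 2) hlt]

theorem convexOn_rat_of_midpoint_le {s : Set ℝ} (hs : Convex ℝ s) {f : ℝ → ℝ}
    (hf : ∀ x ∈ s, ∀ y ∈ s, f ((x + y) / 2) ≤ (f x + f y) / 2) : ConvexOn ℚ s f := by
  have key : ∀ x ∈ s, ∀ y ∈ s, ∀ m k : ℕ, 0 < m → k ≤ m →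
      f ((1 - (k : ℝ) / m) * x + (k : ℝ) / m * y) ≤
        (1 - (k : ℝ) / m) * f x + (k : ℝ) / m * f y := by
    intro x hx y hy m k hm hk
    have hm' : (0 : ℝ) < m := by exact_mod_cast hm
    have hmem : ∀ l : ℕ, l ≤ m → (1 - (l : ℝ) / m) * x + (l : ℝ) / m * y ∈ s := by
      intro l hl
      have hl' : (l : ℝ) / m ≤ 1 := (div_le_one hm').2 (by exact_mod_cast hl)
      exact hs hx hy (by linarith) (by positivity) (by ring)
    have := nonpos_of_discrete_convex (m := m)
      (u := fun l : ℕ => f ((1 - (l : ℝ) / m) * x + (l : ℝ) / m * y) -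
        ((1 - (l : ℝ) / m) * f x + (l : ℝ) / m * f y))
      (by simp) (by simp [hm'.ne']) (fun l hl => by
        have h := hf _ (hmem l (by omega)) _ (hmem (l + 2) hl)
        have e : ((1 - (l : ℝ) / m) * x + (l : ℝ) / m * y +
            ((1 - ((l + 2 : ℕ) : ℝ) / m) * x + ((l + 2 : ℕ) : ℝ) / m * y)) / 2 =
            (1 - ((l + 1 : ℕ) : ℝ) / m) * x + ((l + 1 : ℕ) : ℝ) / m * y := by
          push_cast
          ring
        rw [e] at h
        have e' : 2 * ((1 - ((l + 1 : ℕ) : ℝ) / m) * f x + ((l + 1 : ℕ) : ℝ) / m * f y) =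
            ((1 - (l : ℝ) / m) * f x + (l : ℝ) / m * f y) +
            ((1 - ((l + 2 : ℕ) : ℝ) / m) * f x + ((l + 2 : ℕ) : ℝ) / m * f y) := by
          push_cast
          ring
        linarith) hk
    linarith
  have ratio : ∀ c d : ℚ, 0 ≤ c → 0 ≤ d → c + d = 1 → ∃ m k : ℕ, 0 < m ∧ k ≤ m ∧
      (d : ℝ) = (k : ℝ) / m ∧ (c : ℝ) = 1 - (k : ℝ) / m := by
    intro c d hc hd hcd
    have hnum : ((d.num.toNat : ℕ) : ℤ) = d.num := Int.toNat_of_nonneg (Rat.num_nonneg.2 hd)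
    have hd' : d = (d.num.toNat : ℚ) / d.den := by
      conv_lhs => rw [← Rat.num_div_den d, ← hnum, Int.cast_natCast]
    have hdR : (d : ℝ) = (d.num.toNat : ℝ) / d.den := by
      simpa only [Rat.cast_div, Rat.cast_natCast] using congrArg (Rat.cast (K := ℝ)) hd'
    refine ⟨d.den, d.num.toNat, d.den_pos, ?_, hdR, ?_⟩
    · have h1 : (d.num.toNat : ℚ) / d.den ≤ 1 := by linarith
      rw [div_le_one (by exact_mod_cast d.den_pos)] at h1
      exact_mod_cast h1
    · rw [← hdR, eq_sub_iff_add_eq]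
      exact_mod_cast hcd
  refine ⟨fun x hx y hy c d hc hd hcd => ?_, fun x hx y hy c d hc hd hcd => ?_⟩
  · rw [Rat.smul_def, Rat.smul_def]
    exact hs hx hy (by exact_mod_cast hc) (by exact_mod_cast hd) (by exact_mod_cast hcd)
  · obtain ⟨m, k, hm, hk, hdk, hck⟩ := ratio c d hc hd hcd
    simp only [Rat.smul_def, hdk, hck]
    exact key x hx y hy m k hm hk

theorem rational_jensen_for_h_mid_convex
    (a b : ℝ) (h f : ℝ → ℝ)
    (h_pos : ∀ t : ℝ, 0 < t → 0 < h t)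
    (h_supermul : ∀ x y : ℝ, 0 < x → 0 < y → h x * h y ≤ h (x * y))
    (h_ge : ∀ t : ℝ, 0 < t → t ≤ h t)
    (f_midconv : ∀ x ∈ Set.Icc a b, ∀ y ∈ Set.Icc a b,
      f ((x + y) / 2) ≤ h (1 / 2) * (f x + f y)) :
    ∀ (n : ℕ) (x : Fin n → ℝ) (lam : Fin n → ℚ),
      (∀ i, x i ∈ Set.Icc a b) →
      (∀ i, 0 < lam i) →
      (∑ i, lam i) = 1 →
      f (∑ i, (lam i : ℝ) * x i) ≤ ∑ i, h (lam i : ℝ) * f (x i) := by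
  intro n x lam hx hlam hsum
  have h_id : ∀ t : ℝ, 0 < t → h t = t := fun t ht =>
    eq_self_of_supermultiplicative_of_le h_pos h_supermul h_ge ht
  have hf : ConvexOn ℚ (Set.Icc a b) f :=
    convexOn_rat_of_midpoint_le (convex_Icc a b) fun x hx y hy => by
      have := f_midconv x hx y hy
      rw [h_id _ (by norm_num)] at this
      linarith
  have jensen := hf.map_sum_le (t := Finset.univ) (fun i _ => (hlam i).le) hsum
    (fun i _ => hx i)
  simp only [Rat.smul_def] at jensen
  refine jensen.trans_eq (Finset.sum_congr rfl fun i _ => ?_)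
  rw [h_id _ (by exact_mod_cast hlam i)]
end

section
/- Let h : (0,∞) → (0,∞) be a super-multiplicative function satisfying h(t) ≥ t for all t > 0, and let f : (a,b) → ℝ be a nonnegative h-mid-convex function. Then for every x ∈ (a,b) and every δ ∈ ℝ with x + δ ∈ (a,b) and x − δ ∈ (a,b), one has 2·f(x) ≤ f(x + δ) + f(x − δ). -/
theorem h_mid_convex_wright_inequality
    (a b : ℝ) (h f : ℝ → ℝ)
    (h_pos : ∀ t : ℝ, 0 < t → 0 < h t)
    (h_supermul : ∀ x y : ℝ, 0 < x → 0 < y → h x * h y ≤ h (x * y))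
    (h_ge : ∀ t : ℝ, 0 < t → t ≤ h t)
    (f_nonneg : ∀ x ∈ Set.Ioo a b, 0 ≤ f x)
    (f_midconv : ∀ x ∈ Set.Ioo a b, ∀ y ∈ Set.Ioo a b,
      f ((x + y) / 2) ≤ h (1 / 2) * (f x + f y)) :
    ∀ x ∈ Set.Ioo a b, ∀ δ : ℝ, x + δ ∈ Set.Ioo a b → x - δ ∈ Set.Ioo a b →
      2 * f x ≤ f (x + δ) + f (x - δ) := by
  intro x hx δ hxp hxm
  have h_one : h 1 ≤ 1 := by
    have hmul := h_supermul 1 1 one_pos one_pos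
    rw [mul_one] at hmul
    exact le_of_mul_le_mul_right (by simpa using hmul) (h_pos 1 one_pos)
  have h_half : h (1 / 2) ≤ 1 / 2 := by
    have hmul := h_supermul (1 / 2) 2 (by norm_num) two_pos
    rw [show (1 / 2 : ℝ) * 2 = 1 by norm_num] at hmul
    nlinarith [h_ge 2 two_pos, h_pos (1 / 2) (by norm_num)]
  have hmid := f_midconv _ hxp _ hxm
  rw [show (x + δ + (x - δ)) / 2 = x by ring] at hmid
  have hsum := mul_le_mul_of_nonneg_right h_half
    (add_nonneg (f_nonneg _ hxp) (f_nonneg _ hxm))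
  linarith
end

section
/- (Jensen-type continuity theorem) Let h : (0,∞) → (0,∞) be a continuous multiplicative function (h(xy) = h(x)h(y) for all x, y > 0) satisfying h(t) ≥ t for all t > 0 and h(1) = 1. If f : [a,b] → ℝ is an h-mid-convex function that is bounded above by a constant M on [a,b], then f is continuous on the open interval (a,b). -/
/-- A midpoint-convex function bounded above by `M` on a closed ball of radius `δ` around `x`
increases by at most `(M - f x) / 2 ^ n` on the ball of radius `δ / 2 ^ n`. -/
theorem midconvex_sub_le_div_two_pow {s : Set ℝ} {f : ℝ → ℝ} {M x δ : ℝ}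
    (hf : ∀ y ∈ s, ∀ z ∈ s, f ((y + z) / 2) ≤ (f y + f z) / 2)
    (hM : ∀ y ∈ s, f y ≤ M) (hδ : 0 ≤ δ) (hs : ∀ t, |t| ≤ δ → x + t ∈ s) (n : ℕ) :
    ∀ t, |t| ≤ δ / 2 ^ n → f (x + t) - f x ≤ (M - f x) / 2 ^ n := by
  induction n with
  | zero =>
    intro t ht
    have := hM _ (hs t (by simpa using ht))
    simpa using this
  | succ n ih =>
    intro t ht
    have h2 : |2 * t| ≤ δ / 2 ^ n := by
      rw [abs_mul, abs_two]
      rw [pow_succ, ← div_div] at ht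
      linarith
    have hx : x ∈ s := by simpa using hs 0 (by simpa using hδ)
    have h2s : x + 2 * t ∈ s :=
      hs _ (h2.trans (div_le_self hδ (one_le_pow₀ one_le_two)))
    have hmid := hf x hx _ h2s
    rw [show (x + (x + 2 * t)) / 2 = x + t by ring] at hmid
    have := ih _ h2
    rw [pow_succ, ← div_div]
    linarith

/-- A midpoint-convex function that is bounded above is continuous at interior points. -/
theorem midconvex_continuousAt_of_bddAbove {s : Set ℝ} {f : ℝ → ℝ} {M x : ℝ}
    (hf : ∀ y ∈ s, ∀ z ∈ s, f ((y + z) / 2) ≤ (f y + f z) / 2)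
    (hM : ∀ y ∈ s, f y ≤ M) (hs : s ∈ nhds x) : ContinuousAt f x := by
  obtain ⟨δ, hδ, hball⟩ := Metric.nhds_basis_closedBall.mem_iff.1 hs
  have hsub : ∀ t, |t| ≤ δ → x + t ∈ s := fun t ht =>
    hball (by simpa [Real.dist_eq] using ht)
  rw [Metric.continuousAt_iff]
  intro ε hε
  have hlim : Filter.Tendsto (fun n : ℕ => (M - f x) / 2 ^ n) Filter.atTop (nhds 0) :=
    tendsto_const_nhds.div_atTop (tendsto_pow_atTop_atTop_of_one_lt one_lt_two)
  obtain ⟨n, hn⟩ := (hlim.eventually_lt_const hε).exists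
  refine ⟨δ / 2 ^ n, by positivity, fun {y} hy => ?_⟩
  obtain ⟨t, rfl⟩ : ∃ t, y = x + t := ⟨y - x, by ring⟩
  have ht : |t| ≤ δ / 2 ^ n := by simpa [Real.dist_eq] using hy.le
  have htδ : |t| ≤ δ := ht.trans (div_le_self hδ.le (one_le_pow₀ one_le_two))
  have hup := midconvex_sub_le_div_two_pow hf hM hδ.le hsub n t ht
  have hdown := midconvex_sub_le_div_two_pow hf hM hδ.le hsub n (-t) (by rwa [abs_neg])
  have hmid := hf _ (hsub t htδ) _ (hsub (-t) (by rwa [abs_neg]))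
  rw [show (x + t + (x + -t)) / 2 = x by ring] at hmid
  rw [Real.dist_eq, abs_lt]
  constructor <;> linarith


theorem jensen_continuity_theorem_for_h_mid_convex
    (a b M : ℝ) (h f : ℝ → ℝ)
    (h_pos : ∀ t : ℝ, 0 < t → 0 < h t)
    (h_cont : ContinuousOn h (Set.Ioi (0 : ℝ)))
    (h_mul : ∀ x y : ℝ, 0 < x → 0 < y → h (x * y) = h x * h y)
    (h_ge : ∀ t : ℝ, 0 < t → t ≤ h t)
    (h_one : h 1 = 1)
    (f_midconv : ∀ x ∈ Set.Icc a b, ∀ y ∈ Set.Icc a b,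
      f ((x + y) / 2) ≤ h (1 / 2) * (f x + f y))
    (f_bdd : ∀ x ∈ Set.Icc a b, f x ≤ M) :
    ContinuousOn f (Set.Ioo a b) := by
  have half : h (1 / 2) = 1 / 2 := by
    have hprod : h 2 * h (1 / 2) = 1 := by
      rw [← h_mul 2 (1 / 2) two_pos (by norm_num)]
      norm_num [h_one]
    have := h_ge 2 two_pos
    have := h_ge (1 / 2) (by norm_num)
    nlinarith
  intro x hx
  refine (midconvex_continuousAt_of_bddAbove (fun y hy z hz => ?_) f_bdd
    (Icc_mem_nhds hx.1 hx.2)).continuousWithinAt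
  have := f_midconv y hy z hz
  rw [half] at this
  linarith
end

section
/- Let c > 0 and let M ⊆ ℝ be a Lebesgue measurable set with the property that for every λ ∈ [0,1], either λ·c ∈ M or −λ·c ∈ M. Then the Lebesgue measure of M is at least c. -/
open MeasureTheory

theorem measure_of_reflection_covering_set
    (c : ℝ) (hc : 0 < c) (M : Set ℝ) (hM : MeasurableSet M)
    (hcov : ∀ lam ∈ Set.Icc (0 : ℝ) 1, lam * c ∈ M ∨ -(lam * c) ∈ M) :
    ENNReal.ofReal c ≤ volume M := by
  have hsub : Set.Ioc 0 c ⊆ (M ∩ Set.Ioi 0) ∪ Neg.neg ⁻¹' (M \ Set.Ioi 0) := by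
    rintro x ⟨hx0, hxc⟩
    have h := hcov (x / c) ⟨by positivity, (div_le_one hc).2 hxc⟩
    rw [div_mul_cancel₀ x hc.ne'] at h
    exact h.imp (fun hx ↦ ⟨hx, hx0⟩) fun hx ↦ ⟨hx, by simpa using hx0.le⟩
  calc ENNReal.ofReal c = volume (Set.Ioc 0 c) := by simp
    _ ≤ volume (M ∩ Set.Ioi 0) + volume (Neg.neg ⁻¹' (M \ Set.Ioi 0)) :=
      (measure_mono hsub).trans (measure_union_le _ _)
    _ = volume (M ∩ Set.Ioi 0) + volume (M \ Set.Ioi 0) := by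
      rw [(Measure.measurePreserving_neg volume).measure_preimage
        (hM.diff measurableSet_Ioi).nullMeasurableSet]
    _ = volume M := measure_inter_add_sdiff M measurableSet_Ioi
end

section
/- (Blumberg–Sierpiński-type theorem) Let h : (0,∞) → (0,∞) be a continuous super-multiplicative function satisfying h(t) ≥ t for all t > 0. If f : (a,b) → ℝ is a Lebesgue measurable h-mid-convex function, then f is continuous on (a,b). -/
open MeasureTheory Filter Topology in
/-- A measurable midpoint convex function on an open interval is locally bounded above. -/
theorem exists_forall_le_near_of_measurable_midconvex {a b : ℝ} {f : ℝ → ℝ}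
    (f_meas : Measurable fun x : Set.Ioo a b => f x)
    (f_mid : ∀ x ∈ Set.Ioo a b, ∀ y ∈ Set.Ioo a b, f ((x + y) / 2) ≤ (f x + f y) / 2)
    {x₀ : ℝ} (hx₀ : x₀ ∈ Set.Ioo a b) :
    ∃ r > 0, ∃ M : ℝ, ∀ x, |x - x₀| < r → x ∈ Set.Ioo a b ∧ f x ≤ M := by
  obtain ⟨c, hc, hac, hcb⟩ : ∃ c > 0, a ≤ x₀ - 2 * c ∧ x₀ + 2 * c ≤ b := by
    obtain ⟨h₁, h₂⟩ := hx₀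
    refine ⟨min (x₀ - a) (b - x₀) / 2, by have := lt_min (sub_pos.2 h₁) (sub_pos.2 h₂); linarith,
      ?_, ?_⟩
    · linarith [min_le_left (x₀ - a) (b - x₀)]
    · linarith [min_le_right (x₀ - a) (b - x₀)]
  set J := Set.Ioo (x₀ - 2 * c) (x₀ + 2 * c) with hJ
  have hJab : J ⊆ Set.Ioo a b := Set.Ioo_subset_Ioo hac hcb
  let A : ℕ → Set ℝ := fun n => {y | y ∈ J ∧ f y ≤ n}
  have hA_meas (n : ℕ) : MeasurableSet (A n) := by
    have h₁ : MeasurableSet {y : Set.Ioo a b | f y ≤ n} := f_meas measurableSet_Iic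
    have h₂ := (measurableSet_Ioo.subtype_image h₁).inter (measurableSet_Ioo : MeasurableSet J)
    convert h₂ using 1
    ext y
    constructor
    · rintro ⟨hy, hfy⟩
      exact ⟨⟨⟨y, hJab hy⟩, hfy, rfl⟩, hy⟩
    · rintro ⟨⟨z, hz, rfl⟩, hy⟩
      exact ⟨hy, hz⟩
  have hA_mono : Monotone A := fun m n hmn y hy =>
    ⟨hy.1, hy.2.trans (Nat.cast_le.2 hmn)⟩
  have hA_union : ⋃ n, A n = J := by
    ext y
    simp only [Set.mem_iUnion]
    refine ⟨fun ⟨n, hy⟩ => hy.1, fun hy => ?_⟩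
    obtain ⟨n, hn⟩ := exists_nat_ge (f y)
    exact ⟨n, hy, hn⟩
  obtain ⟨n, hn⟩ : ∃ n, ENNReal.ofReal (3 * c) < volume (A n) := by
    have h := tendsto_measure_iUnion_atTop (μ := volume) hA_mono
    rw [hA_union, hJ, Real.volume_Ioo] at h
    refine (h.eventually_const_lt ?_).exists
    rw [ENNReal.ofReal_lt_ofReal_iff_of_nonneg (by positivity)]
    linarith
  refine ⟨c / 2, by positivity, n, fun x hx => ?_⟩
  rw [abs_lt] at hx
  refine ⟨⟨by linarith, by linarith⟩, ?_⟩
  let B : Set ℝ := (fun y => 2 * x - y) ⁻¹' A n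
  have hB : volume B = volume (A n) :=
    (Measure.measurePreserving_sub_left volume (2 * x)).measure_preimage (hA_meas n).nullMeasurableSet
  obtain ⟨y, hyA, hyB⟩ : (A n ∩ B).Nonempty := by
    by_contra hne
    have hdisj : Disjoint (A n) B :=
      Set.disjoint_iff_inter_eq_empty.2 (Set.not_nonempty_iff_eq_empty.1 hne)
    have hsub : A n ∪ B ⊆ Set.Ioo (x₀ - 3 * c) (x₀ + 3 * c) := by
      rintro y (⟨⟨h₁, h₂⟩, -⟩ | ⟨⟨h₁, h₂⟩, -⟩) <;> constructor <;> linarith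
    have hle := measure_mono (μ := volume) hsub
    rw [measure_union' hdisj (hA_meas n), hB, Real.volume_Ioo] at hle
    have hlt := ENNReal.add_lt_add hn hn
    rw [← ENNReal.ofReal_add (by positivity) (by positivity)] at hlt
    refine (hlt.trans_le hle).ne ?_
    congr 1
    ring
  have h := f_mid y (hJab hyA.1) (2 * x - y) (hJab hyB.1)
  rw [show (y + (2 * x - y)) / 2 = x by ring] at h
  have h₁ := hyA.2
  have h₂ : f (2 * x - y) ≤ n := hyB.2
  linarith

/-- A midpoint convex function that is bounded above near a point is continuous there. -/
theorem continuousAt_of_midconvex_of_forall_le {f : ℝ → ℝ} {x₀ r M : ℝ} (hr : 0 < r)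
    (f_mid : ∀ x y, |x - x₀| < r → |y - x₀| < r → f ((x + y) / 2) ≤ (f x + f y) / 2)
    (hM : ∀ x, |x - x₀| < r → f x ≤ M) : ContinuousAt f x₀ := by
  have upper (n : ℕ) : ∀ u : ℝ, 2 ^ n * |u| < r →
      2 ^ n * (f (x₀ + u) - f x₀) ≤ M - f x₀ := by
    induction n with
    | zero =>
      intro u hu
      have := hM (x₀ + u) (by simpa using hu)
      linarith
    | succ n ih =>
      intro u hu
      have h2u : |2 * u| = 2 * |u| := by rw [abs_mul, abs_two]
      have hpow : (1 : ℝ) ≤ 2 ^ n := one_le_pow₀ one_le_two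
      have hu' : 2 ^ n * |2 * u| < r := by rw [h2u]; convert hu using 1; ring
      have h₁ := ih (2 * u) hu'
      have h₂ := f_mid x₀ (x₀ + 2 * u) (by simpa using hr) (by
        rw [add_sub_cancel_left]
        nlinarith [abs_nonneg (2 * u)])
      rw [show (x₀ + (x₀ + 2 * u)) / 2 = x₀ + u by ring] at h₂
      calc (2 : ℝ) ^ (n + 1) * (f (x₀ + u) - f x₀)
          = 2 ^ n * (2 * (f (x₀ + u) - f x₀)) := by ring
        _ ≤ 2 ^ n * (f (x₀ + 2 * u) - f x₀) := by gcongr; linarith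
        _ ≤ M - f x₀ := h₁
  rw [Metric.continuousAt_iff]
  intro ε hε
  obtain ⟨n, hn⟩ := pow_unbounded_of_one_lt ((M - f x₀) / ε) (one_lt_two (α := ℝ))
  rw [div_lt_iff₀ hε] at hn
  have hpow : (0 : ℝ) < 2 ^ n := by positivity
  have hpow₁ : (1 : ℝ) ≤ 2 ^ n := one_le_pow₀ one_le_two
  have close (u : ℝ) (hu : 2 ^ n * |u| < r) : f (x₀ + u) - f x₀ < ε :=
    lt_of_mul_lt_mul_left ((upper n u hu).trans_lt hn) hpow.le
  refine ⟨r / 2 ^ n, by positivity, fun {x} hx => ?_⟩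
  rw [Real.dist_eq, lt_div_iff₀ hpow, mul_comm] at hx
  have hxr : |x - x₀| < r := by nlinarith [abs_nonneg (x - x₀)]
  have h₁ := close (x - x₀) hx
  have h₂ := close (-(x - x₀)) (by rwa [abs_neg])
  have h₃ := f_mid (x₀ + (x - x₀)) (x₀ + -(x - x₀)) (by simpa using hxr)
    (by rwa [add_sub_cancel_left, abs_neg])
  rw [show (x₀ + (x - x₀) + (x₀ + -(x - x₀))) / 2 = x₀ by ring] at h₃
  rw [add_sub_cancel] at h₁ h₃
  rw [Real.dist_eq, abs_lt]
  constructor <;> linarith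

theorem blumberg_sierpinski_for_h_mid_convex
    (a b : ℝ) (h f : ℝ → ℝ)
    (h_pos : ∀ t : ℝ, 0 < t → 0 < h t)
    (h_cont : ContinuousOn h (Set.Ioi (0 : ℝ)))
    (h_supermul : ∀ x y : ℝ, 0 < x → 0 < y → h x * h y ≤ h (x * y))
    (h_ge : ∀ t : ℝ, 0 < t → t ≤ h t)
    (f_meas : Measurable fun x : Set.Ioo a b => f x)
    (f_midconv : ∀ x ∈ Set.Ioo a b, ∀ y ∈ Set.Ioo a b,
      f ((x + y) / 2) ≤ h (1 / 2) * (f x + f y)) :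
    ContinuousOn f (Set.Ioo a b) := by
  have h_half : h (1 / 2) = 1 / 2 := by
    have h₁ := h_supermul 1 1 one_pos one_pos
    have h₂ := h_supermul 2 (1 / 2) two_pos one_half_pos
    have h₃ := h_ge 2 two_pos
    have h₄ := h_ge (1 / 2) one_half_pos
    have h₅ := h_pos 1 one_pos
    norm_num at h₁ h₂ h₄ ⊢
    have h₆ : h 1 ≤ 1 := by nlinarith
    nlinarith
  have f_mid : ∀ x ∈ Set.Ioo a b, ∀ y ∈ Set.Ioo a b, f ((x + y) / 2) ≤ (f x + f y) / 2 := by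
    intro x hx y hy
    have := f_midconv x hx y hy
    rw [h_half] at this
    linarith
  intro x₀ hx₀
  obtain ⟨r, hr, M, hM⟩ := exists_forall_le_near_of_measurable_midconvex f_meas f_mid hx₀
  exact (continuousAt_of_midconvex_of_forall_le hr
    (fun x y hx hy => f_mid x (hM x hx).1 y (hM y hy).1)
    (fun x hx => (hM x hx).2)).continuousWithinAt
end

section
/- (Mehdi-type theorem) Let h : (0,∞) → (0,∞) be a continuous super-multiplicative function satisfying h(t) ≥ t for all t > 0 and h(1) = 1. Let I ⊆ ℝ be an interval and let f : I → ℝ be an h-mid-convex function that is bounded above on a subset S ⊆ I which is non-meagre (of second Baire category) and has the Baire property. Then f is continuous on the interior of I, and hence f is h-convex on the interior of I. -/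
open Set Filter Topology

/-- Jensen (midpoint) convexity of a real function on a set. -/
def MidpointConvexOn (s : Set ℝ) (f : ℝ → ℝ) : Prop :=
  ∀ x ∈ s, ∀ y ∈ s, f ((x + y) / 2) ≤ (f x + f y) / 2

theorem eq_self_of_supermul {h : ℝ → ℝ}
    (h_supermul : ∀ x y : ℝ, 0 < x → 0 < y → h x * h y ≤ h (x * y))
    (h_ge : ∀ t : ℝ, 0 < t → t ≤ h t) (h_one : h 1 = 1) {t : ℝ} (ht : 0 < t) : h t = t := by
  have hprod := h_supermul t t⁻¹ ht (inv_pos.2 ht)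
  rw [mul_inv_cancel₀ ht.ne', h_one] at hprod
  refine le_antisymm ?_ (h_ge t ht)
  have hle : h t * t⁻¹ ≤ 1 :=
    (mul_le_mul_of_nonneg_left (h_ge _ (inv_pos.2 ht)) (ht.le.trans (h_ge t ht))).trans hprod
  rwa [← div_eq_mul_inv, div_le_one ht] at hle

/-- Every point of the open set residually equal to `s` is a midpoint of two points of `s`. -/
theorem exists_midpoint_of_residualEq {s u : Set ℝ} (hu : IsOpen u) (hsu : s =ᵇ u)
    {z : ℝ} (hz : z ∈ u) : ∃ x ∈ s, ∃ y ∈ s, z = (x + y) / 2 := by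
  let e : ℝ ≃ₜ ℝ := Homeomorph.subLeft (2 * z)
  have he : Tendsto e (residual ℝ) (residual ℝ) := e.residual_map_eq.le
  have hdense := dense_of_mem_residual ((eventuallyEq_set.1 hsu).and
    (he.eventually (eventuallyEq_set.1 hsu)))
  have hmem : z ∈ u ∩ e ⁻¹' u := ⟨hz, by
    have : e z = z := by simp [e]; ring
    simpa [this] using hz⟩
  obtain ⟨x, ⟨hxu, hxu'⟩, hx, hx'⟩ :=
    hdense.inter_open_nonempty _ (hu.inter (hu.preimage e.continuous)) ⟨z, hmem⟩
  refine ⟨x, hx.2 hxu, e x, hx'.2 hxu', ?_⟩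
  simp [e]

namespace MidpointConvexOn

variable {s : Set ℝ} {f : ℝ → ℝ}

theorem dyadic (hf : MidpointConvexOn s f) (hs : Convex ℝ s) {x y : ℝ} (hx : x ∈ s)
    (hy : y ∈ s) (n : ℕ) :
    f ((1 - (1 / 2) ^ n) * x + (1 / 2) ^ n * y) ≤ (1 - (1 / 2) ^ n) * f x + (1 / 2) ^ n * f y := by
  induction n with
  | zero => simp
  | succ n ih =>
    have hmem : (1 - (1 / 2 : ℝ) ^ n) * x + (1 / 2) ^ n * y ∈ s :=
      hs hx hy (sub_nonneg.2 (pow_le_one₀ (by norm_num) (by norm_num))) (by positivity) (by ring)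
    have hmid := hf x hx _ hmem
    have harg : (x + ((1 - (1 / 2 : ℝ) ^ n) * x + (1 / 2) ^ n * y)) / 2 =
        (1 - (1 / 2) ^ (n + 1)) * x + (1 / 2) ^ (n + 1) * y := by ring
    rw [harg] at hmid
    rw [pow_succ] at hmid ⊢
    linarith

theorem exists_local_upper_bound (hf : MidpointConvexOn s f) (hs : Convex ℝ s) {c ρ M : ℝ}
    (hρ : 0 < ρ) (hball : Metric.ball c ρ ⊆ s) (hM : ∀ x ∈ Metric.ball c ρ, f x ≤ M)
    {x : ℝ} (hx : x ∈ interior s) :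
    ∃ r > 0, ∃ K, ∀ w ∈ Metric.ball x r, w ∈ s ∧ f w ≤ K := by
  have hpow : Tendsto (fun n : ℕ ↦ (1 / 2 : ℝ) ^ n) atTop (𝓝 0) :=
    tendsto_pow_atTop_nhds_zero_of_lt_one (by norm_num) (by norm_num)
  have hlim : Tendsto (fun n : ℕ ↦ x + (x - c) * ((1 / 2 : ℝ) ^ n / (1 - (1 / 2) ^ n)))
      atTop (𝓝 x) := by
    simpa using ((hpow.div (hpow.const_sub 1) (by norm_num)).const_mul (x - c)).const_add x
  obtain ⟨n, hy, hn⟩ := ((hlim.eventually (mem_interior_iff_mem_nhds.1 hx)).and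
    (hpow.eventually (gt_mem_nhds one_pos))).exists
  generalize hyd : x + (x - c) * ((1 / 2 : ℝ) ^ n / (1 - (1 / 2) ^ n)) = y at hy
  have ha : 0 < (1 / 2 : ℝ) ^ n := by positivity
  refine ⟨(1 / 2) ^ n * ρ, by positivity, (1 - (1 / 2) ^ n) * f y + (1 / 2) ^ n * M, ?_⟩
  intro w hw
  have hz : c + (w - x) / (1 / 2) ^ n ∈ Metric.ball c ρ := by
    rw [Metric.mem_ball, Real.dist_eq] at hw ⊢
    rw [add_sub_cancel_left, abs_div, abs_of_pos ha, div_lt_iff₀ ha]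
    linarith
  have hwe : w = (1 - (1 / 2) ^ n) * y + (1 / 2) ^ n * (c + (w - x) / (1 / 2) ^ n) := by
    have hne : 1 - (1 / 2 : ℝ) ^ n ≠ 0 := (sub_pos.2 hn).ne'
    rw [← hyd]
    generalize (1 / 2 : ℝ) ^ n = a at *
    field_simp
    ring
  constructor
  · rw [hwe]
    exact hs hy (hball hz) (sub_pos.2 hn).le ha.le (by ring)
  · rw [hwe]
    exact (hf.dyadic hs hy (hball hz) n).trans
      (add_le_add_right (mul_le_mul_of_nonneg_left (hM _ hz) ha.le) _)

theorem continuousAt (hf : MidpointConvexOn s f) (hs : Convex ℝ s) {x r K : ℝ} (hr : 0 < r)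
    (hK : ∀ w ∈ Metric.ball x r, w ∈ s ∧ f w ≤ K) : ContinuousAt f x := by
  have hxs := (hK x (Metric.mem_ball_self hr)).1
  have hupper (n : ℕ) (w : ℝ) (hw : |w - x| < (1 / 2) ^ n * r) :
      f w - f x ≤ (1 / 2) ^ n * (K - f x) := by
    have ha : 0 < (1 / 2 : ℝ) ^ n := by positivity
    have hz : x + (w - x) / (1 / 2) ^ n ∈ Metric.ball x r := by
      rw [Metric.mem_ball, Real.dist_eq, add_sub_cancel_left, abs_div, abs_of_pos ha,
        div_lt_iff₀ ha]
      linarith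
    have hd := hf.dyadic hs hxs (hK _ hz).1 n
    have hwe : (1 - (1 / 2) ^ n) * x + (1 / 2) ^ n * (x + (w - x) / (1 / 2) ^ n) = w := by
      field_simp
      ring
    rw [hwe] at hd
    have := mul_le_mul_of_nonneg_left (hK _ hz).2 ha.le
    linarith
  have hlim : Tendsto (fun n : ℕ ↦ (1 / 2 : ℝ) ^ n * (K - f x)) atTop (𝓝 0) := by
    simpa using (tendsto_pow_atTop_nhds_zero_of_lt_one (r := (1 / 2 : ℝ))
      (by norm_num) (by norm_num)).mul_const (K - f x)
  rw [Metric.continuousAt_iff]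
  intro ε hε
  obtain ⟨n, hn⟩ := (hlim.eventually (gt_mem_nhds hε)).exists
  refine ⟨(1 / 2) ^ n * r, by positivity, fun w hw ↦ ?_⟩
  rw [Real.dist_eq] at hw ⊢
  have hw' : |(2 * x - w) - x| < (1 / 2) ^ n * r := by
    rwa [show (2 * x - w) - x = -(w - x) by ring, abs_neg]
  have hle : (1 / 2 : ℝ) ^ n * r ≤ r :=
    mul_le_of_le_one_left hr.le (pow_le_one₀ (by norm_num) (by norm_num))
  have hmid := hf w (hK w (hw.trans_le hle)).1 (2 * x - w) (hK _ (hw'.trans_le hle)).1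
  rw [show (w + (2 * x - w)) / 2 = x by ring] at hmid
  have h₁ := hupper n w hw
  have h₂ := hupper n _ hw'
  rw [abs_lt]
  constructor <;> linarith

/-- The **Bernstein–Doetsch theorem** on the real line. -/
theorem continuousOn_interior (hf : MidpointConvexOn s f) (hs : Convex ℝ s) {u : Set ℝ}
    (hu : IsOpen u) (hne : u.Nonempty) (hus : u ⊆ s) {M : ℝ} (hM : ∀ x ∈ u, f x ≤ M) :
    ContinuousOn f (interior s) := by
  obtain ⟨c, hc⟩ := hne
  obtain ⟨ρ, hρ, hball⟩ := Metric.isOpen_iff.1 hu c hc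
  intro x hx
  obtain ⟨r, hr, K, hK⟩ := hf.exists_local_upper_bound hs hρ (hball.trans hus)
    (fun z hz ↦ hM z (hball hz)) hx
  exact (hf.continuousAt hs hr hK).continuousWithinAt

theorem nonpos_of_continuousOn {g : ℝ → ℝ} (hg : MidpointConvexOn (Icc 0 1) g)
    (hc : ContinuousOn g (Icc 0 1)) (h0 : g 0 = 0) (h1 : g 1 = 0) {t : ℝ}
    (ht : t ∈ Icc (0 : ℝ) 1) : g t ≤ 0 := by
  by_contra! hpos
  obtain ⟨m, hm, hmax⟩ := isCompact_Icc.exists_isMaxOn ⟨t, ht⟩ hc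
  have hcomp : IsCompact (Icc (0 : ℝ) 1 ∩ g ⁻¹' {g m}) :=
    isCompact_Icc.of_isClosed_subset (hc.preimage_isClosed_of_isClosed isClosed_Icc
      isClosed_singleton) inter_subset_left
  obtain ⟨a, ⟨ha, hga⟩, hleast⟩ := hcomp.exists_isLeast ⟨m, hm, rfl⟩
  have hga : g a = g m := hga
  have hapos : 0 < g a := hga ▸ hpos.trans_le (hmax ht)
  have ha0 : 0 < a := ha.1.lt_of_ne (by rintro rfl; exact hapos.ne' h0)
  have ha1 : a < 1 := ha.2.lt_of_ne (by rintro rfl; exact hapos.ne' h1)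
  obtain ⟨d, hd, hda, hd1⟩ : ∃ d > 0, d ≤ a ∧ d ≤ 1 - a :=
    ⟨min a (1 - a), lt_min ha0 (sub_pos.2 ha1), min_le_left _ _, min_le_right _ _⟩
  have hl : a - d ∈ Icc (0 : ℝ) 1 := ⟨by linarith, by linarith⟩
  have hr : a + d ∈ Icc (0 : ℝ) 1 := ⟨by linarith, by linarith⟩
  have hlt : g (a - d) < g m := (hmax hl).lt_of_ne fun heq ↦ by
    have := hleast ⟨hl, heq⟩
    linarith
  have hle : g (a + d) ≤ g m := hmax hr
  have hmid := hg _ hl _ hr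
  rw [show (a - d + (a + d)) / 2 = a by ring] at hmid
  linarith

/-- A continuous midpoint convex function is convex. -/
theorem convexOn (hf : MidpointConvexOn s f) (hs : Convex ℝ s) (hc : ContinuousOn f s) :
    ConvexOn ℝ s f := by
  refine ⟨hs, fun x hx y hy a b ha hb hab ↦ ?_⟩
  obtain rfl : b = 1 - a := by linarith
  simp only [smul_eq_mul]
  have hmaps : MapsTo (fun t : ℝ ↦ t * x + (1 - t) * y) (Icc 0 1) s := fun t ht ↦
    hs hx hy ht.1 (sub_nonneg.2 ht.2) (by ring)
  have hnonpos := nonpos_of_continuousOn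
    (g := fun t ↦ f (t * x + (1 - t) * y) - (t * f x + (1 - t) * f y)) ?_ ?_ (by simp) (by simp)
    (t := a) ⟨ha, by linarith⟩
  · linarith
  · intro p hp q hq
    have hmid := hf _ (hmaps hp) _ (hmaps hq)
    have harg : (p * x + (1 - p) * y + (q * x + (1 - q) * y)) / 2 =
        (p + q) / 2 * x + (1 - (p + q) / 2) * y := by ring
    simp only [harg] at hmid ⊢
    linarith
  · exact (hc.comp (by fun_prop) hmaps).sub (by fun_prop)

end MidpointConvexOn

theorem mehdi_for_h_mid_convex
    (I : Set ℝ) (hI : Convex ℝ I) (h f : ℝ → ℝ)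
    (h_pos : ∀ t : ℝ, 0 < t → 0 < h t)
    (h_cont : ContinuousOn h (Set.Ioi (0 : ℝ)))
    (h_supermul : ∀ x y : ℝ, 0 < x → 0 < y → h x * h y ≤ h (x * y))
    (h_ge : ∀ t : ℝ, 0 < t → t ≤ h t)
    (h_one : h 1 = 1)
    (f_midconv : ∀ x ∈ I, ∀ y ∈ I, f ((x + y) / 2) ≤ h (1 / 2) * (f x + f y))
    (hS : ∃ (S : Set ℝ) (M : ℝ), S ⊆ I ∧ ¬ IsMeagre S ∧ BaireMeasurableSet S ∧
      ∀ x ∈ S, f x ≤ M) :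
    ContinuousOn f (interior I) ∧
      ∀ x ∈ interior I, ∀ y ∈ interior I, ∀ t ∈ Set.Ioo (0 : ℝ) 1,
        f (t * x + (1 - t) * y) ≤ h t * f x + h (1 - t) * f y := by

  have hself {t : ℝ} (ht : 0 < t) : h t = t := eq_self_of_supermul h_supermul h_ge h_one ht
  have hf : MidpointConvexOn I f := fun x hx y hy ↦ by
    have := f_midconv x hx y hy
    rw [hself (by norm_num)] at this
    linarith
  obtain ⟨S, M, hSI, hSm, hSb, hM⟩ := hS
  obtain ⟨u, hu, hSu⟩ := hSb.residualEq_isOpen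
  have hne : u.Nonempty := by
    rw [nonempty_iff_ne_empty]
    rintro rfl
    apply hSm
    filter_upwards [eventuallyEq_set.1 hSu] with x hx hxS using hx.1 hxS
  have huI : u ⊆ I := fun z hz ↦ by
    obtain ⟨x, hx, y, hy, rfl⟩ := exists_midpoint_of_residualEq hu hSu hz
    have := hI (hSI hx) (hSI hy) (a := 1 / 2) (b := 1 / 2) (by norm_num) (by norm_num) (by norm_num)
    convert this using 1
    simp only [smul_eq_mul]
    ring
  have huM : ∀ z ∈ u, f z ≤ M := fun z hz ↦ by
    obtain ⟨x, hx, y, hy, rfl⟩ := exists_midpoint_of_residualEq hu hSu hz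
    linarith [hf x (hSI hx) y (hSI hy), hM x hx, hM y hy]
  have hcont := hf.continuousOn_interior hI hu hne huI huM
  refine ⟨hcont, fun x hx y hy t ht ↦ ?_⟩
  have hint : MidpointConvexOn (interior I) f := fun x hx y hy ↦
    hf x (interior_subset hx) y (interior_subset hy)
  rw [hself ht.1, hself (sub_pos.2 ht.2)]
  exact (hint.convexOn hI.interior hcont).2 hx hy ht.1.le (sub_pos.2 ht.2).le (by ring)
end

section
/- Let h : (0,∞) → (0,∞) be a super-multiplicative function satisfying h(t) ≥ t for all t > 0, and let f : [a,b] → ℝ be an h-mid-convex function. Then for all x, y ∈ [a,b] and every rational λ ∈ (0,1), f(λ·x + (1−λ)·y) ≤ h(λ)·f(x) + h(1−λ)·f(y). -/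
/-- A finite convex sequence vanishing at `0` lies below its chords through the origin. -/
theorem mul_le_mul_of_discrete_convex {n : ℕ} {u : ℕ → ℝ} (u_zero : u 0 = 0)
    (u_conv : ∀ k, k + 2 ≤ n → 2 * u (k + 1) ≤ u k + u (k + 2)) {k : ℕ} (hkn : k ≤ n) :
    (n : ℝ) * u k ≤ k * u n := by
  have h_step : ∀ m : ℕ, m + 1 ≤ n → ((m : ℝ) + 1) * u m ≤ m * u (m + 1) := by
    intro m
    induction m with
    | zero => simp [u_zero]
    | succ m ih =>
      intro hm
      have h₁ := ih (by omega)
      have h₂ := mul_le_mul_of_nonneg_left (u_conv m hm) (by positivity : (0 : ℝ) ≤ m + 1)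
      push_cast
      linarith
  rcases Nat.eq_zero_or_pos k with rfl | hk
  · simp [u_zero]
  suffices ∀ m, k ≤ m → m ≤ n → (m : ℝ) * u k ≤ k * u m from this n hkn le_rfl
  intro m hkm
  induction m, hkm using Nat.le_induction with
  | base => simp
  | succ m hkm ih =>
    intro hm
    have h₁ := mul_le_mul_of_nonneg_left (h_step m hm) (Nat.cast_nonneg (α := ℝ) k)
    have h₂ := mul_le_mul_of_nonneg_left (ih (by omega)) (by positivity : (0 : ℝ) ≤ m + 1)
    have hm_pos : (0 : ℝ) < m := by exact_mod_cast hk.trans_le hkm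
    push_cast
    refine le_of_mul_le_mul_left ?_ hm_pos
    linarith

/-- A midpoint convex function on a convex set satisfies the convexity inequality for weights
`k / n`. -/
theorem le_of_midpoint_convex {s : Set ℝ} (hs : Convex ℝ s) {f : ℝ → ℝ}
    (f_midconv : ∀ x ∈ s, ∀ y ∈ s, f ((x + y) / 2) ≤ 1 / 2 * (f x + f y))
    {x y : ℝ} (hx : x ∈ s) (hy : y ∈ s) {k n : ℕ} (hn : 0 < n) (hkn : k ≤ n) :
    f ((k / n : ℝ) * x + (1 - (k / n : ℝ)) * y) ≤
      (k / n : ℝ) * f x + (1 - (k / n : ℝ)) * f y := by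
  have hn' : (0 : ℝ) < n := by exact_mod_cast hn
  set z : ℕ → ℝ := fun j => (j / n : ℝ) * x + (1 - (j / n : ℝ)) * y with hz
  have z_mem : ∀ j ≤ n, z j ∈ s := by
    intro j hj
    have hj' : (j / n : ℝ) ≤ 1 := (div_le_one hn').2 (by exact_mod_cast hj)
    exact hs hx hy (by positivity) (sub_nonneg.2 hj') (by ring)
  have h_chord := mul_le_mul_of_discrete_convex (n := n) (u := fun j => f (z j) - f y)
    (by simp [hz]) (fun j hj => by
      have h_mid := f_midconv _ (z_mem j (by omega)) _ (z_mem (j + 2) hj)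
      have h_eq : (z j + z (j + 2)) / 2 = z (j + 1) := by
        simp only [hz]
        push_cast
        ring
      rw [h_eq] at h_mid
      linarith) hkn
  have z_last : z n = x := by simp [hz, hn'.ne']
  simp only [z_last] at h_chord
  change f (z k) ≤ _
  have h_div : f (z k) - f y ≤ k * (f x - f y) / n := by
    rw [le_div_iff₀ hn']
    linarith
  calc f (z k) ≤ k * (f x - f y) / n + f y := by linarith
    _ = _ := by ring

theorem rational_h_convexity_of_h_mid_convex
    (a b : ℝ) (h f : ℝ → ℝ)
    (h_pos : ∀ t : ℝ, 0 < t → 0 < h t)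
    (h_supermul : ∀ x y : ℝ, 0 < x → 0 < y → h x * h y ≤ h (x * y))
    (h_ge : ∀ t : ℝ, 0 < t → t ≤ h t)
    (f_midconv : ∀ x ∈ Set.Icc a b, ∀ y ∈ Set.Icc a b,
      f ((x + y) / 2) ≤ h (1 / 2) * (f x + f y)) :
    ∀ x ∈ Set.Icc a b, ∀ y ∈ Set.Icc a b, ∀ lam : ℚ, 0 < lam → lam < 1 →
      f ((lam : ℝ) * x + (1 - (lam : ℝ)) * y) ≤
        h (lam : ℝ) * f x + h (1 - (lam : ℝ)) * f y := by
  intro x hx y hy lam h_lam_pos h_lam_lt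
  have h_eq : ∀ t : ℝ, 0 < t → h t = t := fun t ht =>
    eq_self_of_supermul_of_le h_supermul h_ge ht
  rw [h_eq lam (by exact_mod_cast h_lam_pos),
    h_eq (1 - lam) (sub_pos.2 (by exact_mod_cast h_lam_lt))]
  rw [h_eq (1 / 2) (by norm_num)] at f_midconv
  have h_num : ((lam.num.toNat : ℕ) : ℤ) = lam.num :=
    Int.toNat_of_nonneg (Rat.num_nonneg.2 h_lam_pos.le)
  have h_le : lam.num.toNat ≤ lam.den := by
    have := Rat.num_le_denom_iff.2 h_lam_lt.le
    omega
  have h_cast : (lam : ℝ) = (lam.num.toNat : ℝ) / (lam.den : ℝ) := by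
    rw [← Int.cast_natCast (R := ℝ) lam.num.toNat, h_num, Rat.cast_def]
  rw [h_cast]
  exact le_of_midpoint_convex (convex_Icc a b) f_midconv hx hy lam.den_pos h_le
end

section
/- Let h : (0,∞) → (0,∞) be a super-multiplicative function satisfying h(t) ≥ t for all t > 0, and let f : [a,b] → ℝ be an h-mid-convex function. Then for every n ∈ ℕ with n ≥ 3, if the Jensen-type inequality f((x₁+⋯+xₙ)/n) ≤ h(1/n)·(f(x₁)+⋯+f(xₙ)) holds for all x₁, …, xₙ ∈ [a,b], then also f((x₁+⋯+x_{n−1})/(n−1)) ≤ h(1/(n−1))·(f(x₁)+⋯+f(x_{n−1})) holds for all x₁, …, x_{n−1} ∈ [a,b]. -/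
theorem jensen_step_down_for_h_mid_convex
    (a b : ℝ) (h f : ℝ → ℝ)
    (h_pos : ∀ t : ℝ, 0 < t → 0 < h t)
    (h_supermul : ∀ x y : ℝ, 0 < x → 0 < y → h x * h y ≤ h (x * y))
    (h_ge : ∀ t : ℝ, 0 < t → t ≤ h t)
    (f_midconv : ∀ x ∈ Set.Icc a b, ∀ y ∈ Set.Icc a b,
      f ((x + y) / 2) ≤ h (1 / 2) * (f x + f y)) :
    ∀ n : ℕ, 3 ≤ n →
      (∀ x : Fin n → ℝ, (∀ i, x i ∈ Set.Icc a b) →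
        f ((∑ i, x i) / n) ≤ h (1 / n) * ∑ i, f (x i)) →
      (∀ x : Fin (n - 1) → ℝ, (∀ i, x i ∈ Set.Icc a b) →
        f ((∑ i, x i) / ((n : ℝ) - 1)) ≤ h (1 / ((n : ℝ) - 1)) * ∑ i, f (x i)) := by
  intro n hn hJ x hx
  obtain ⟨m, rfl⟩ : ∃ m, n = m + 1 := ⟨n - 1, by omega⟩
  have hm : (0 : ℝ) < m := by exact_mod_cast (by omega : 0 < m)
  change Fin m → ℝ at x
  change ∀ i : Fin m, x i ∈ Set.Icc a b at hx
  change f ((∑ i : Fin m, x i) / (((m + 1 : ℕ) : ℝ) - 1)) ≤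
    h (1 / (((m + 1 : ℕ) : ℝ) - 1)) * ∑ i : Fin m, f (x i)
  have hcast : ((m + 1 : ℕ) : ℝ) - 1 = m := by push_cast; ring
  rw [hcast, eq_self_of_supermul_of_le h_supermul h_ge (by positivity)]
  set A := (∑ i : Fin m, x i) / (m : ℝ) with hA
  have hsum : ∑ i : Fin m, x i = m * A := by rw [hA]; field_simp
  have hmem : A ∈ Set.Icc a b := by
    constructor
    · rw [hA, le_div_iff₀ hm]
      simpa [mul_comm] using
        Finset.card_nsmul_le_sum Finset.univ x a fun i _ => (hx i).1
    · rw [hA, div_le_iff₀ hm]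
      simpa [mul_comm] using
        Finset.sum_le_card_nsmul Finset.univ x b fun i _ => (hx i).2
  have key := hJ (Fin.cons A x) (Fin.cases hmem hx)
  rw [eq_self_of_supermul_of_le h_supermul h_ge (by positivity)] at key
  simp only [Fin.sum_univ_succ, Fin.cons_zero, Fin.cons_succ, hsum] at key
  have hmean : (A + m * A) / ((m + 1 : ℕ) : ℝ) = A := by push_cast; field_simp; ring
  rw [hmean, one_div_mul_eq_div, le_div_iff₀ (by positivity)] at key
  push_cast at key
  rw [one_div_mul_eq_div, le_div_iff₀ hm]
  linarith
end

section
/- Let h : (0,∞) → (0,∞) be a super-multiplicative function satisfying h(t) ≥ t for all t > 0, and let f : [a,b] → ℝ be an h-mid-convex function. Then for every k ∈ ℕ and every x₁, …, x_{2^k} ∈ [a,b], one has f((x₁ + ⋯ + x_{2^k})/2^k) ≤ h(1/2^k)·(f(x₁) + ⋯ + f(x_{2^k})). -/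
/-- Iterating `f ((x + y) / 2) ≤ c * (f x + f y)` over a dyadic number of points of a convex set. -/
lemma map_dyadic_average_le {s : Set ℝ} (hs : Convex ℝ s) {f : ℝ → ℝ} {c : ℝ} (hc : 0 ≤ c)
    (hf : ∀ x ∈ s, ∀ y ∈ s, f ((x + y) / 2) ≤ c * (f x + f y)) (k : ℕ)
    (x : Fin (2 ^ k) → ℝ) (hx : ∀ i, x i ∈ s) :
    f ((∑ i, x i) / (2 ^ k : ℝ)) ≤ c ^ k * ∑ i, f (x i) := by
  induction k with
  | zero => simp
  | succ k ih =>
    let e : Fin (2 ^ k) × Fin 2 ≃ Fin (2 ^ (k + 1)) := finProdFinEquiv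
    have sum_pairs (g : Fin (2 ^ (k + 1)) → ℝ) :
        ∑ i, g i = ∑ i, (g (e (i, 0)) + g (e (i, 1))) := by
      rw [← e.sum_comp, Fintype.sum_prod_type]
      simp only [Fin.sum_univ_two]
    have hmid (i : Fin (2 ^ k)) : (x (e (i, 0)) + x (e (i, 1))) / 2 ∈ s := by
      convert hs (hx (e (i, 0))) (hx (e (i, 1))) (a := 1 / 2) (b := 1 / 2)
        (by norm_num) (by norm_num) (by norm_num) using 1
      simp only [smul_eq_mul]
      ring
    calc f ((∑ i, x i) / (2 ^ (k + 1) : ℝ))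
        = f ((∑ i, (x (e (i, 0)) + x (e (i, 1))) / 2) / (2 ^ k : ℝ)) := by
          rw [sum_pairs x, ← Finset.sum_div, div_div, pow_succ' (2 : ℝ)]
      _ ≤ c ^ k * ∑ i, f ((x (e (i, 0)) + x (e (i, 1))) / 2) := ih _ hmid
      _ ≤ c ^ k * ∑ i, c * (f (x (e (i, 0))) + f (x (e (i, 1)))) := by
          gcongr with i
          exact hf _ (hx _) _ (hx _)
      _ = c ^ (k + 1) * ∑ i, f (x i) := by
          rw [sum_pairs fun i => f (x i), ← Finset.mul_sum, pow_succ c, mul_assoc]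

/-- A positive super-multiplicative function with `1 ≤ h 1` satisfies `h t ^ k ≤ h (t ^ k)`. -/
lemma pow_le_map_pow_of_supermul {h : ℝ → ℝ} (h_pos : ∀ t : ℝ, 0 < t → 0 < h t)
    (h_supermul : ∀ x y : ℝ, 0 < x → 0 < y → h x * h y ≤ h (x * y)) (h_one : 1 ≤ h 1)
    {t : ℝ} (ht : 0 < t) (k : ℕ) : h t ^ k ≤ h (t ^ k) := by
  induction k with
  | zero => simpa using h_one
  | succ k ih =>
    rw [pow_succ, pow_succ]
    exact (mul_le_mul_of_nonneg_right ih (h_pos t ht).le).trans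
      (h_supermul _ _ (pow_pos ht k) ht)

/-- A super-multiplicative function above the identity that touches it at one positive point
agrees with it everywhere on the positive reals. -/
lemma map_eq_self_of_supermul {h : ℝ → ℝ}
    (h_supermul : ∀ x y : ℝ, 0 < x → 0 < y → h x * h y ≤ h (x * y))
    (h_ge : ∀ t : ℝ, 0 < t → t ≤ h t) {u : ℝ} (hu : 0 < u) (h_u : h u = u)
    {t : ℝ} (ht : 0 < t) : h t = t := by
  refine le_antisymm ?_ (h_ge t ht)
  have hut : 0 < u / t := div_pos hu ht
  refine le_of_mul_le_mul_right ?_ hut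
  calc h t * (u / t) ≤ h t * h (u / t) :=
        mul_le_mul_of_nonneg_left (h_ge _ hut) (ht.le.trans (h_ge t ht))
    _ ≤ h (t * (u / t)) := h_supermul _ _ ht hut
    _ = t * (u / t) := by rw [mul_div_cancel₀ u ht.ne', h_u]

theorem dyadic_jensen_for_h_mid_convex
    (a b : ℝ) (h f : ℝ → ℝ)
    (h_pos : ∀ t : ℝ, 0 < t → 0 < h t)
    (h_supermul : ∀ x y : ℝ, 0 < x → 0 < y → h x * h y ≤ h (x * y))
    (h_ge : ∀ t : ℝ, 0 < t → t ≤ h t)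
    (f_midconv : ∀ x ∈ Set.Icc a b, ∀ y ∈ Set.Icc a b,
      f ((x + y) / 2) ≤ h (1 / 2) * (f x + f y)) :
    ∀ (k : ℕ) (x : Fin (2 ^ k) → ℝ), (∀ i, x i ∈ Set.Icc a b) →
      f ((∑ i, x i) / (2 ^ k : ℝ)) ≤ h (1 / (2 ^ k : ℝ)) * ∑ i, f (x i) := by
  intro k x hx
  have h_half : 0 < h (1 / 2) := h_pos _ (by norm_num)
  refine (map_dyadic_average_le (convex_Icc a b) h_half.le f_midconv k x hx).trans ?_
  rw [← one_div_pow]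
  rcases (h_ge (1 / 2) (by norm_num)).eq_or_lt with heq | hlt
  · rw [← heq, map_eq_self_of_supermul h_supermul h_ge (by norm_num) heq.symm (by positivity)]
  · refine mul_le_mul_of_nonneg_right
      (pow_le_map_pow_of_supermul h_pos h_supermul (h_ge 1 one_pos) (by norm_num) k)
      (Finset.sum_nonneg fun i _ => ?_)
    have hmid := f_midconv _ (hx i) _ (hx i)
    rw [add_self_div_two] at hmid
    nlinarith
end
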